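/- For every 1 ≤ p < ∞ there is a constant C_p > 0 with the following property: for every integer n ≥ 2 and every continuous function f : 𝕋 → ℝ, not identically 0, whose Fourier coefficients satisfy f̂(k) = 0 for all integers k with |k| < n (in particular f has mean zero), one has W_p( max{f, 0} dx, max{−f, 0} dx ) ≤ C_p (1/n) ( log( n ‖f‖_{L²(𝕋)} / ‖f‖_{L¹(𝕋)} ) )^{1/2} ‖f‖_{L¹(𝕋)}^{1/p}. -/

import Mathlib

open MeasureTheory
open scoped ENNReal

/-- The `p`-Wasserstein distance between measures on the torus `𝕋 = ℝ/ℤ`,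
defined as the infimum of `(∫ |x-y|^p dγ)^(1/p)` over all couplings `γ`. -/
noncomputable def Wdist (p : ℝ) (μ ν : Measure UnitAddCircle) : ℝ :=
  sInf { c : ℝ | ∃ γ : Measure (UnitAddCircle × UnitAddCircle),
      γ.map Prod.fst = μ ∧ γ.map Prod.snd = ν ∧
      c = (∫ z, dist z.1 z.2 ^ p ∂γ) ^ (1 / p) }

/-- The `k`-th Fourier coefficient of a real-valued function on the torus. -/
noncomputable def fhat (f : UnitAddCircle → ℝ) (k : ℤ) : ℂ :=
  fourierCoeff (fun x => (f x : ℂ)) k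

open ProbabilityTheory

/-- There is a coupling of `μ` and `ν` whose `p`-th order transport cost is at most `K`. -/
def HasCouplingCostLE {X : Type*} [MeasurableSpace X] [EDist X] (p : ℝ) (μ ν : Measure X)
    (K : ℝ≥0∞) : Prop :=
  ∃ γ : Measure (X × X), γ.map Prod.fst = μ ∧ γ.map Prod.snd = ν ∧
    ∫⁻ z, edist z.1 z.2 ^ p ∂γ ≤ K

lemma exists_gluing {X Y Z : Type*} [MeasurableSpace X] [StandardBorelSpace X] [Nonempty X]
    [MeasurableSpace Y] [MeasurableSpace Z] [StandardBorelSpace Z] [Nonempty Z]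
    (γ : Measure (X × Y)) (η : Measure (Y × Z)) [IsFiniteMeasure γ] [IsFiniteMeasure η]
    (h : γ.map Prod.snd = η.map Prod.fst) :
    ∃ π : Measure (Y × X × Z), π.map (fun w => (w.2.1, w.1)) = γ ∧
      π.map (fun w => (w.1, w.2.2)) = η := by
  set γ' := γ.map Prod.swap with hγ'
  have hfst : γ'.fst = η.fst := by
    rw [hγ', Measure.fst_map_swap]; exact h
  refine ⟨η.fst ⊗ₘ (γ'.condKernel ×ₖ η.condKernel), ?_, ?_⟩
  · have h1 : (η.fst ⊗ₘ (γ'.condKernel ×ₖ η.condKernel)).map (fun w => (w.1, w.2.1)) = γ' := by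
      change (η.fst ⊗ₘ (γ'.condKernel ×ₖ η.condKernel)).map (Prod.map id Prod.fst) = γ'
      rw [← Measure.compProd_map measurable_fst, ← Kernel.fst_eq, Kernel.fst_prod, ← hfst,
        Measure.disintegrate]
    have h2 : γ = γ'.map Prod.swap := by
      rw [hγ', Measure.map_map measurable_swap measurable_swap]; simp
    conv_rhs => rw [h2, ← h1]
    rw [Measure.map_map measurable_swap (by fun_prop)]
    rfl
  · change (η.fst ⊗ₘ (γ'.condKernel ×ₖ η.condKernel)).map (Prod.map id Prod.snd) = η
    rw [← Measure.compProd_map measurable_snd, ← Kernel.snd_eq, Kernel.snd_prod,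
      Measure.disintegrate]

lemma HasCouplingCostLE.symm {X : Type*} [MeasurableSpace X] [PseudoEMetricSpace X] {p : ℝ}
    {μ ν : Measure X} {K : ℝ≥0∞} (h : HasCouplingCostLE p μ ν K) : HasCouplingCostLE p ν μ K := by
  obtain ⟨γ, h1, h2, h3⟩ := h
  refine ⟨γ.map Prod.swap, ?_, ?_, ?_⟩
  · rw [Measure.map_map measurable_fst measurable_swap, ← h2]; rfl
  · rw [Measure.map_map measurable_snd measurable_swap, ← h1]; rfl
  · refine le_trans (le_of_eq ?_) h3
    change ∫⁻ z, edist z.1 z.2 ^ p ∂(γ.map MeasurableEquiv.prodComm) = _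
    rw [lintegral_map_equiv]
    exact lintegral_congr fun z => by rw [edist_comm]; rfl

lemma HasCouplingCostLE.trans {X : Type*} [MeasurableSpace X] [PseudoEMetricSpace X]
    [StandardBorelSpace X] [Nonempty X] [OpensMeasurableSpace X] [SecondCountableTopology X]
    {p : ℝ} (hp : 1 ≤ p) {μ ν ρ : Measure X} [IsFiniteMeasure μ] [IsFiniteMeasure ν]
    {K L : ℝ≥0∞} (h : HasCouplingCostLE p μ ν K) (h' : HasCouplingCostLE p ν ρ L) :
    HasCouplingCostLE p μ ρ (2 ^ (p - 1) * (K + L)) := by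
  obtain ⟨γ, h1, h2, h3⟩ := h
  obtain ⟨η, h1', h2', h3'⟩ := h'
  have : IsFiniteMeasure γ := by
    have : IsFiniteMeasure (γ.map Prod.fst) := by rw [h1]; infer_instance
    exact Measure.isFiniteMeasure_of_map measurable_fst.aemeasurable
  have : IsFiniteMeasure η := by
    have : IsFiniteMeasure (η.map Prod.fst) := by rw [h1']; infer_instance
    exact Measure.isFiniteMeasure_of_map measurable_fst.aemeasurable
  obtain ⟨π, e1, e2⟩ := exists_gluing γ η (h2.trans h1'.symm)
  have m : Measurable fun z : X × X => edist z.1 z.2 ^ p := by fun_prop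
  refine ⟨π.map Prod.snd, ?_, ?_, ?_⟩
  · rw [← h1, ← e1, Measure.map_map (by fun_prop) (by fun_prop),
      Measure.map_map (by fun_prop) (by fun_prop)]; rfl
  · rw [← h2', ← e2, Measure.map_map (by fun_prop) (by fun_prop),
      Measure.map_map (by fun_prop) (by fun_prop)]; rfl
  · rw [lintegral_map m measurable_snd]
    calc ∫⁻ w, edist w.2.1 w.2.2 ^ p ∂π
        ≤ ∫⁻ w, 2 ^ (p - 1) * (edist w.2.1 w.1 ^ p + edist w.1 w.2.2 ^ p) ∂π := by
          refine lintegral_mono fun w => ?_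
          refine le_trans ?_ (ENNReal.rpow_add_le_mul_rpow_add_rpow _ _ hp)
          exact ENNReal.rpow_le_rpow (edist_triangle _ _ _) (by linarith)
      _ = 2 ^ (p - 1) * (∫⁻ z, edist z.1 z.2 ^ p ∂γ + ∫⁻ z, edist z.1 z.2 ^ p ∂η) := by
          rw [lintegral_const_mul _ (by fun_prop), lintegral_add_left (by fun_prop), ← e1, ← e2,
            lintegral_map m (by fun_prop), lintegral_map m (by fun_prop)]
      _ ≤ _ := by gcongr

lemma hasCouplingCostLE_conv {G : Type*} [MeasurableSpace G] [SeminormedAddCommGroup G]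
    [BorelSpace G] [SecondCountableTopology G] (p : ℝ) (μ τ : Measure G) [SFinite μ]
    [IsProbabilityMeasure τ] :
    HasCouplingCostLE p μ (μ ∗ τ) (μ Set.univ * ∫⁻ z, ‖z‖ₑ ^ p ∂τ) := by
  refine ⟨(μ.prod τ).map fun z => (z.1, z.1 + z.2), ?_, ?_, ?_⟩
  · rw [Measure.map_map (by fun_prop) (by fun_prop)]
    change (μ.prod τ).map Prod.fst = μ
    simp
  · rw [Measure.map_map (by fun_prop) (by fun_prop)]
    rfl
  · rw [lintegral_map (by fun_prop) (by fun_prop), lintegral_prod _ (by fun_prop)]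
    simp [edist_eq_enorm_sub, mul_comm]

lemma hasCouplingCostLE_withDensity {X : Type*} [MeasurableSpace X] [PseudoEMetricSpace X]
    [OpensMeasurableSpace X] [SecondCountableTopology X]
    {p : ℝ} (hp : 0 < p) (hX : ∀ x y : X, edist x y ≤ 1) (ρ : Measure X) [SFinite ρ]
    {u w : X → ℝ≥0∞} (hu : Measurable u) (hw : Measurable w) (hfin : ∫⁻ x, u x ∂ρ ≠ ∞)
    (huw : ∫⁻ x, u x ∂ρ = ∫⁻ x, w x ∂ρ) :
    HasCouplingCostLE p (ρ.withDensity u) (ρ.withDensity w) (∫⁻ x, (u x - w x) ∂ρ) := by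
  set a := ρ.withDensity (fun x => u x - w x) with ha
  set b := ρ.withDensity (fun x => w x - u x) with hb
  set h := ρ.withDensity (fun x => min (u x) (w x)) with hh
  set c := ∫⁻ x, (u x - w x) ∂ρ with hc
  have hua : ρ.withDensity u = h + a := by
    rw [hh, ha, ← withDensity_add_left (by fun_prop)]
    congr 1; ext x; simp only [Pi.add_apply]
    rcases le_total (u x) (w x) with H | H <;> simp [H, tsub_eq_zero_of_le]
  have hwb : ρ.withDensity w = h + b := by
    rw [hh, hb, ← withDensity_add_left (by fun_prop)]
    congr 1; ext x; simp only [Pi.add_apply]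
    rcases le_total (u x) (w x) with H | H <;> simp [H, tsub_eq_zero_of_le]
  have hau : a Set.univ = c := by simp [ha, hc]
  have hmfin : h Set.univ ≠ ∞ := by
    refine ne_top_of_le_ne_top hfin ?_
    simp only [hh, withDensity_apply _ MeasurableSet.univ, Measure.restrict_univ]
    exact lintegral_mono fun x => min_le_left _ _
  have hbu : b Set.univ = c := by
    have h1 := congrArg (fun m => m Set.univ) hua
    have h2 := congrArg (fun m => m Set.univ) hwb
    simp only [withDensity_apply _ MeasurableSet.univ, Measure.restrict_univ,
      Measure.add_apply] at h1 h2
    rw [huw, h2, hau] at h1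
    exact (ENNReal.add_right_inj hmfin).1 h1
  have hcfin : c ≠ ∞ := ne_top_of_le_ne_top hfin (lintegral_mono fun x => tsub_le_self)
  have hsf : SFinite a := by rw [ha]; infer_instance
  have hsf' : SFinite b := by rw [hb]; infer_instance
  have hcc : ∀ m : Measure X, m Set.univ = c → c⁻¹ • c • m = m := by
    intro m hm
    rcases eq_or_ne c 0 with h0 | h0
    · have : m = 0 := by rw [← Measure.measure_univ_eq_zero, hm, h0]
      simp [this]
    · rw [smul_smul, ENNReal.inv_mul_cancel h0 hcfin, one_smul]
  refine ⟨h.map (fun x => (x, x)) + c⁻¹ • a.prod b, ?_, ?_, ?_⟩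
  · rw [Measure.map_add _ _ measurable_fst, Measure.map_map measurable_fst (by fun_prop),
      Measure.map_smul, Measure.map_fst_prod, hbu, hcc a hau, hua]
    congr 1; exact Measure.map_id
  · rw [Measure.map_add _ _ measurable_snd, Measure.map_map measurable_snd (by fun_prop),
      Measure.map_smul, Measure.map_snd_prod, hau, hcc b hbu, hwb]
    congr 1; exact Measure.map_id
  · rw [lintegral_add_measure, lintegral_map (by fun_prop) (by fun_prop), lintegral_smul_measure]
    simp only [edist_self, ENNReal.zero_rpow_of_pos hp, lintegral_zero, zero_add]
    calc c⁻¹ • ∫⁻ z, edist z.1 z.2 ^ p ∂(a.prod b)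
        ≤ c⁻¹ • ∫⁻ z, 1 ∂(a.prod b) := by
          gcongr with z
          exact ENNReal.rpow_le_one (hX _ _) hp.le
      _ = c⁻¹ * c * c := by
          rw [lintegral_one, ← Set.univ_prod_univ, Measure.prod_prod, hau, hbu, smul_eq_mul,
            mul_assoc]
      _ ≤ 1 * c := by gcongr; exact ENNReal.inv_mul_le_one c
      _ = c := one_mul c

lemma withDensity_conv {G : Type*} [MeasurableSpace G] [AddCommGroup G] [MeasurableAdd₂ G]
    [MeasurableNeg G] (ρ τ : Measure G) [SFinite ρ] [SFinite τ] [ρ.IsAddRightInvariant]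
    {g : G → ℝ≥0∞} (hg : Measurable g) :
    ρ.withDensity g ∗ τ = ρ.withDensity fun x => ∫⁻ z, g (x - z) ∂τ := by
  have : MeasurableSub₂ G := ⟨by simp only [sub_eq_add_neg]; fun_prop⟩
  have hm : Measurable fun x => ∫⁻ z, g (x - z) ∂τ :=
    Measurable.lintegral_prod_right' (f := fun q : G × G => g (q.1 - q.2)) (by fun_prop)
  refine Measure.ext_of_lintegral _ fun φ hφ => ?_
  rw [Measure.lintegral_conv hφ, lintegral_withDensity_eq_lintegral_mul _ hg
    (Measurable.lintegral_prod_right' (f := fun q : G × G => φ (q.1 + q.2)) (by fun_prop)),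
    lintegral_withDensity_eq_lintegral_mul _ hm hφ]
  simp only [Pi.mul_apply]
  have h1 : ∀ x, g x * ∫⁻ z, φ (x + z) ∂τ = ∫⁻ z, g x * φ (x + z) ∂τ := fun x =>
    (lintegral_const_mul _ (by fun_prop)).symm
  have h2 : ∀ x, (∫⁻ z, g (x - z) ∂τ) * φ x = ∫⁻ z, g (x - z) * φ x ∂τ := fun x =>
    (lintegral_mul_const _ (by fun_prop)).symm
  simp only [h1, h2]
  refine (lintegral_lintegral_swap (by fun_prop)).trans
    (Eq.trans ?_ (lintegral_lintegral_swap (by fun_prop)))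
  refine lintegral_congr fun z => ?_
  rw [← lintegral_sub_right_eq_self (μ := ρ) (fun x => g x * φ (x + z)) z]
  simp

lemma UnitAddCircle.volume_eq_haarAddCircle :
    (volume : Measure UnitAddCircle) = AddCircle.haarAddCircle := by
  simp [AddCircle.volume_eq_smul_haarAddCircle]

lemma fourierCoeff_integral_sub {f : UnitAddCircle → ℂ} (hf : Continuous f)
    (τ : Measure UnitAddCircle) [IsFiniteMeasure τ] (k : ℤ) :
    fourierCoeff (fun x => ∫ z, f (x - z) ∂τ) k = (∫ z, fourier (-k) z ∂τ) * fourierCoeff f k := by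
  simp only [fourierCoeff, ← integral_smul]
  rw [integral_integral_swap]
  · rw [← integral_mul_const]
    refine integral_congr_ae (.of_forall fun z => ?_)
    dsimp only
    rw [← integral_add_right_eq_self (μ := AddCircle.haarAddCircle)
      (fun x : UnitAddCircle => fourier (-k) x • f (x - z)) z, ← integral_const_mul]
    refine integral_congr_ae (.of_forall fun x => ?_)
    simp only [add_sub_cancel_right, smul_eq_mul, fourier_apply, smul_add, AddCircle.toCircle_add,
      Circle.coe_mul]
    ring
  · exact Continuous.integrable_of_hasCompactSupport (by fun_prop)
      (HasCompactSupport.of_compactSpace _)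

lemma hasSum_sq_norm_fourierCoeff_of_continuous {f : UnitAddCircle → ℂ} (hf : Continuous f) :
    HasSum (fun k => ‖fourierCoeff f k‖ ^ 2) (∫ x, ‖f x‖ ^ 2) := by
  have hL : MemLp f 2 AddCircle.haarAddCircle :=
    hf.memLp_of_hasCompactSupport (HasCompactSupport.of_compactSpace _)
  have h := hasSum_sq_fourierCoeff hL.toLp
  have e := hL.coeFn_toLp
  rw [UnitAddCircle.volume_eq_haarAddCircle]
  convert h using 1
  · ext k
    congr 2
    exact integral_congr_ae (e.mono fun x hx => by simp [hx])
  · exact integral_congr_ae (e.mono fun x hx => by simp [hx])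

lemma continuous_integral_sub {f : UnitAddCircle → ℂ} (hf : Continuous f)
    (τ : Measure UnitAddCircle) [IsFiniteMeasure τ] : Continuous fun x => ∫ z, f (x - z) ∂τ := by
  obtain ⟨B, hB⟩ := isCompact_univ.exists_bound_of_continuousOn hf.continuousOn
  refine continuous_of_dominated (bound := fun _ => B) (fun x => ?_) (fun x => ?_)
    (integrable_const _) (.of_forall fun z => by fun_prop)
  · exact (by fun_prop : Continuous fun z => f (x - z)).aestronglyMeasurable
  · exact .of_forall fun z => hB _ trivial

lemma integral_norm_integral_sub_le {f : UnitAddCircle → ℂ} (hf : Continuous f)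
    (τ : Measure UnitAddCircle) [IsFiniteMeasure τ] {ε : ℝ} (hε : 0 ≤ ε)
    (h : ∀ k, fourierCoeff f k ≠ 0 → ‖∫ z, fourier (-k) z ∂τ‖ ≤ ε) :
    ∫ x, ‖∫ z, f (x - z) ∂τ‖ ≤ ε * √(∫ x, ‖f x‖ ^ 2) := by
  have : IsProbabilityMeasure (volume : Measure UnitAddCircle) := by
    rw [UnitAddCircle.volume_eq_haarAddCircle]; infer_instance
  set F : UnitAddCircle → ℂ := fun x => ∫ z, f (x - z) ∂τ with hF
  have hFc : Continuous F := continuous_integral_sub hf τ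
  have hsq : ∫ x, ‖F x‖ ^ 2 ≤ ε ^ 2 * ∫ x, ‖f x‖ ^ 2 := by
    refine hasSum_le (fun k => ?_) (hasSum_sq_norm_fourierCoeff_of_continuous hFc)
      ((hasSum_sq_norm_fourierCoeff_of_continuous hf).mul_left (ε ^ 2))
    rw [hF, fourierCoeff_integral_sub hf, norm_mul, mul_pow]
    by_cases h0 : fourierCoeff f k = 0
    · simp [h0]
    · gcongr
      exact h k h0
  have hint : ∀ g : UnitAddCircle → ℝ, Continuous g → Integrable g := fun g hg =>
    hg.integrable_of_hasCompactSupport (HasCompactSupport.of_compactSpace _)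
  have hcs : (∫ x, ‖F x‖) ^ 2 ≤ ∫ x, ‖F x‖ ^ 2 :=
    (even_two.convexOn_pow (𝕜 := ℝ)).map_integral_le (by fun_prop) isClosed_univ
      (.of_forall fun _ => trivial) (hint _ (by fun_prop)) (hint _ (by fun_prop))
  rw [← Real.sqrt_sq hε, ← Real.sqrt_mul (sq_nonneg ε)]
  exact Real.le_sqrt_of_sq_le (hcs.trans hsq)

/-- The centred Gaussian of standard deviation `σ`, wrapped around the circle. -/
noncomputable def wrappedGaussian (σ : ℝ) : Measure UnitAddCircle :=
  (gaussianReal 0 1).map fun z : ℝ => ((σ * z : ℝ) : UnitAddCircle)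

lemma UnitAddCircle.measurable_coe_mul (σ : ℝ) :
    Measurable fun z : ℝ => ((σ * z : ℝ) : UnitAddCircle) :=
  ((AddCircle.continuous_mk' 1).comp (continuous_const_mul σ)).measurable

instance (σ : ℝ) : IsProbabilityMeasure (wrappedGaussian σ) :=
  Measure.isProbabilityMeasure_map (UnitAddCircle.measurable_coe_mul σ).aemeasurable

lemma norm_integral_fourier_wrappedGaussian_le (σ : ℝ) (k : ℤ) :
    ‖∫ z, fourier k z ∂wrappedGaussian σ‖ ≤ Real.exp (-(k * σ) ^ 2) := by
  have h : ∫ z, fourier k z ∂wrappedGaussian σ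
      = charFun (gaussianReal 0 1) (2 * Real.pi * k * σ) := by
    rw [wrappedGaussian, integral_map (UnitAddCircle.measurable_coe_mul σ).aemeasurable
      (map_continuous _).aestronglyMeasurable, charFun_apply_real]
    refine integral_congr_ae (.of_forall fun z => ?_)
    simp only [fourier_coe_apply]
    push_cast
    congr 1
    ring
  rw [h, charFun_gaussianReal]
  have e : ((2 * Real.pi * k * σ : ℝ) : ℂ) * ((0 : ℝ) : ℂ) * Complex.I
      - ((1 : NNReal) : ℂ) * ((2 * Real.pi * k * σ : ℝ) : ℂ) ^ 2 / 2
      = ((-((2 * Real.pi * k * σ) ^ 2 / 2) : ℝ) : ℂ) := by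
    push_cast; simp
  rw [e, Complex.norm_exp_ofReal]
  refine Real.exp_le_exp.2 (neg_le_neg ?_)
  have := Real.pi_gt_three
  have h9 : 9 ≤ Real.pi ^ 2 := by nlinarith
  nlinarith [sq_nonneg (k * σ), mul_nonneg (sub_nonneg.2 h9) (sq_nonneg (k * σ))]

lemma lintegral_enorm_rpow_gaussianReal_ne_top {p : ℝ} (hp : 0 < p) :
    ∫⁻ z, ‖z‖ₑ ^ p ∂gaussianReal 0 1 ≠ ∞ := by
  have h := (memLp_id_gaussianReal (μ := 0) (v := 1) p.toNNReal).eLpNorm_lt_top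
  rw [eLpNorm_lt_top_iff_lintegral_rpow_enorm_lt_top (by simpa using hp) (by simp)] at h
  simpa [hp.le] using h.ne

lemma lintegral_enorm_rpow_wrappedGaussian_le {p : ℝ} (hp : 0 ≤ p) (σ : ℝ) :
    ∫⁻ z, ‖z‖ₑ ^ p ∂wrappedGaussian σ ≤ ‖σ‖ₑ ^ p * ∫⁻ z, ‖z‖ₑ ^ p ∂gaussianReal 0 1 := by
  rw [wrappedGaussian, lintegral_map (by fun_prop) (UnitAddCircle.measurable_coe_mul σ),
    ← lintegral_const_mul _ (by fun_prop)]
  refine lintegral_mono fun z => ?_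
  rw [← ENNReal.mul_rpow_of_nonneg _ _ hp, ← enorm_mul]
  gcongr
  rw [enorm_le_iff_norm_le]
  exact QuotientAddGroup.norm_mk_le_norm

lemma HasCouplingCostLE.mono {X : Type*} [MeasurableSpace X] [EDist X] {p : ℝ} {μ ν : Measure X}
    {K L : ℝ≥0∞} (h : HasCouplingCostLE p μ ν K) (hKL : K ≤ L) : HasCouplingCostLE p μ ν L := by
  obtain ⟨γ, h1, h2, h3⟩ := h
  exact ⟨γ, h1, h2, h3.trans hKL⟩

lemma Wdist_le_of_hasCouplingCostLE {p : ℝ} (hp : 0 < p) {μ ν : Measure UnitAddCircle} {K : ℝ}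
    (hK : 0 ≤ K) (h : HasCouplingCostLE p μ ν (ENNReal.ofReal K)) :
    Wdist p μ ν ≤ K ^ (1 / p) := by
  obtain ⟨γ, h1, h2, h3⟩ := h
  have hbdd : BddBelow { c : ℝ | ∃ γ : Measure (UnitAddCircle × UnitAddCircle),
      γ.map Prod.fst = μ ∧ γ.map Prod.snd = ν ∧
      c = (∫ z, dist z.1 z.2 ^ p ∂γ) ^ (1 / p) } := by
    refine ⟨0, ?_⟩
    rintro _ ⟨η, -, -, rfl⟩
    exact Real.rpow_nonneg (integral_nonneg fun z => by positivity) _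
  refine (csInf_le hbdd ⟨γ, h1, h2, rfl⟩).trans ?_
  refine Real.rpow_le_rpow (integral_nonneg fun z => by positivity) ?_ (by positivity)
  rw [integral_eq_lintegral_of_nonneg_ae (.of_forall fun z => by positivity)
    (Measurable.aestronglyMeasurable (by fun_prop))]
  refine ENNReal.toReal_le_of_le_ofReal hK (le_trans (le_of_eq ?_) h3)
  exact lintegral_congr fun z => by
    rw [edist_dist, ENNReal.ofReal_rpow_of_nonneg dist_nonneg hp.le]

lemma UnitAddCircle.edist_le_one (x y : UnitAddCircle) : edist x y ≤ 1 := by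
  rw [edist_dist, ENNReal.ofReal_le_one, dist_eq_norm]
  exact (AddCircle.norm_le_half_period 1 one_ne_zero).trans (by norm_num)

lemma hasCouplingCostLE_conv_posPart_negPart {p : ℝ} (hp : 0 < p) {f : UnitAddCircle → ℝ}
    (hf : Continuous f) (hf0 : ∫ x, f x = 0) (τ : Measure UnitAddCircle)
    [IsProbabilityMeasure τ] :
    HasCouplingCostLE p
      ((volume.withDensity fun x => ENNReal.ofReal (max (f x) 0)) ∗ τ)
      ((volume.withDensity fun x => ENNReal.ofReal (max (-f x) 0)) ∗ τ)
      (ENNReal.ofReal (∫ x, ‖∫ z, (f (x - z) : ℂ) ∂τ‖)) := by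
  have hint : ∀ (ρ : Measure UnitAddCircle) [IsFiniteMeasure ρ] (g : UnitAddCircle → ℝ),
      Continuous g → Integrable g ρ := fun ρ _ g hg =>
    hg.integrable_of_hasCompactSupport (HasCompactSupport.of_compactSpace _)
  have hmeas : ∀ g : UnitAddCircle → ℝ≥0∞, Measurable g →
      Measurable fun x => ∫⁻ z, g (x - z) ∂τ := fun g hg =>
    Measurable.lintegral_prod_right' (f := fun q : UnitAddCircle × UnitAddCircle => g (q.1 - q.2))
      (by fun_prop)
  have hmass : ∀ g : UnitAddCircle → ℝ≥0∞, Measurable g →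
      ∫⁻ x, ∫⁻ z, g (x - z) ∂τ = ∫⁻ x, g x := fun g hg => by
    rw [lintegral_lintegral_swap (by fun_prop)]
    simp [lintegral_sub_right_eq_self]
  have hu : Measurable fun x => ENNReal.ofReal (max (f x) 0) :=
    (by fun_prop : Continuous fun x => max (f x) 0).measurable.ennreal_ofReal
  have hw : Measurable fun x => ENNReal.ofReal (max (-f x) 0) :=
    (by fun_prop : Continuous fun x => max (-f x) 0).measurable.ennreal_ofReal
  rw [withDensity_conv _ _ hu, withDensity_conv _ _ hw]
  have e1 : ∀ (ρ : Measure UnitAddCircle) [IsFiniteMeasure ρ] (g : UnitAddCircle → ℝ),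
      Continuous g → ∫⁻ z, ENNReal.ofReal (max (g z) 0) ∂ρ
        = ENNReal.ofReal (∫ z, max (g z) 0 ∂ρ) := fun ρ _ g hg =>
    (ofReal_integral_eq_lintegral_ofReal (hint ρ _ (by fun_prop))
      (.of_forall fun z => le_max_right _ _)).symm
  have e2 : ∀ (ρ : Measure UnitAddCircle) [IsFiniteMeasure ρ] (g : UnitAddCircle → ℝ),
      Continuous g → ∫ z, max (g z) 0 ∂ρ - ∫ z, max (-g z) 0 ∂ρ = ∫ z, g z ∂ρ := fun ρ _ g hg => by
    rw [← integral_sub (hint ρ _ (by fun_prop)) (hint ρ _ (by fun_prop))]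
    refine integral_congr_ae (.of_forall fun z => ?_)
    simp only
    rcases le_total (g z) 0 with H | H
    · rw [max_eq_right H, max_eq_left (neg_nonneg.2 H)]; ring
    · rw [max_eq_left H, max_eq_right (neg_nonpos.2 H)]; ring
  refine (hasCouplingCostLE_withDensity hp UnitAddCircle.edist_le_one volume (hmeas _ hu)
    (hmeas _ hw) ?_ ?_).mono ?_
  · rw [hmass _ hu, e1 _ _ hf]
    exact ENNReal.ofReal_ne_top
  · rw [hmass _ hu, hmass _ hw, e1 _ _ hf, e1 _ (fun x => -f x) hf.neg]
    congr 1
    have := e2 volume f hf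
    rw [hf0] at this
    linarith
  · have hF := continuous_integral_sub (f := fun x => (f x : ℂ)) (by fun_prop) τ
    rw [ofReal_integral_eq_lintegral_ofReal (hint _ _ hF.norm) (.of_forall fun x => norm_nonneg _)]
    refine lintegral_mono fun x => ?_
    rw [e1 τ (fun z => f (x - z)) (by fun_prop), e1 τ (fun z => -f (x - z)) (by fun_prop),
      ← ENNReal.ofReal_sub (q := ∫ z, max (-f (x - z)) 0 ∂τ) _
        (integral_nonneg fun z => le_max_right _ _),
      e2 τ (fun z => f (x - z)) (by fun_prop), integral_complex_ofReal, Complex.norm_real]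
    exact ENNReal.ofReal_le_ofReal (le_abs_self _)

lemma hasCouplingCostLE_posPart_negPart {p : ℝ} (hp : 1 ≤ p) {f : UnitAddCircle → ℝ}
    (hf : Continuous f) {n : ℕ} (hn : 0 < n) (hfh : ∀ k : ℤ, |k| < (n : ℤ) → fhat f k = 0)
    {σ : ℝ} (hσ : 0 ≤ σ) :
    HasCouplingCostLE p (volume.withDensity fun x => ENNReal.ofReal (max (f x) 0))
      (volume.withDensity fun x => ENNReal.ofReal (max (-f x) 0))
      (ENNReal.ofReal (2 ^ (p - 1) * (2 ^ (p - 1) * ((∫ x, |f x|) *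
          (σ ^ p * (∫⁻ z, ‖z‖ₑ ^ p ∂gaussianReal 0 1).toReal)
        + Real.exp (-(n * σ) ^ 2) * √(∫ x, f x ^ 2)) + (∫ x, |f x|) *
          (σ ^ p * (∫⁻ z, ‖z‖ₑ ^ p ∂gaussianReal 0 1).toReal)))) := by
  have hint : ∀ g : UnitAddCircle → ℝ, Continuous g → Integrable g := fun g hg =>
    hg.integrable_of_hasCompactSupport (HasCompactSupport.of_compactSpace _)
  have hf0 : ∫ x, f x = 0 := by
    have h := hfh 0 (by simpa using hn)
    rw [fhat, fourierCoeff, ← UnitAddCircle.volume_eq_haarAddCircle] at h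
    simpa [integral_complex_ofReal] using h
  have hsmooth : ∀ g : UnitAddCircle → ℝ, Continuous g → (∀ x, g x ≤ |f x|) →
      HasCouplingCostLE p (volume.withDensity fun x => ENNReal.ofReal (max (g x) 0))
        ((volume.withDensity fun x => ENNReal.ofReal (max (g x) 0)) ∗ wrappedGaussian σ)
        (ENNReal.ofReal ((∫ x, |f x|) *
          (σ ^ p * (∫⁻ z, ‖z‖ₑ ^ p ∂gaussianReal 0 1).toReal))) := by
    intro g hg hgf
    refine (hasCouplingCostLE_conv p _ _).mono ?_
    rw [ENNReal.ofReal_mul (integral_nonneg fun x => abs_nonneg _)]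
    refine mul_le_mul' ?_ ?_
    · rw [withDensity_apply _ MeasurableSet.univ, Measure.restrict_univ,
        ofReal_integral_eq_lintegral_ofReal (hint _ (by fun_prop))
          (.of_forall fun x => abs_nonneg _)]
      exact lintegral_mono fun x => ENNReal.ofReal_le_ofReal (max_le (hgf x) (abs_nonneg _))
    · refine (lintegral_enorm_rpow_wrappedGaussian_le (by linarith) σ).trans (le_of_eq ?_)
      rw [ENNReal.ofReal_mul (by positivity), ENNReal.ofReal_toReal
        (lintegral_enorm_rpow_gaussianReal_ne_top (by linarith)), Real.enorm_of_nonneg hσ,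
        ENNReal.ofReal_rpow_of_nonneg hσ (by linarith)]
  have hmid := (hasCouplingCostLE_conv_posPart_negPart (p := p) (by linarith) hf hf0
    (wrappedGaussian σ)).mono (ENNReal.ofReal_le_ofReal
      (integral_norm_integral_sub_le (f := fun x => (f x : ℂ)) (by fun_prop) (wrappedGaussian σ)
        (ε := Real.exp (-(n * σ) ^ 2)) (Real.exp_nonneg _) fun k hk => by
          refine (norm_integral_fourier_wrappedGaussian_le σ (-k)).trans (Real.exp_le_exp.2 ?_)
          have hnk : (n : ℝ) ≤ |(k : ℝ)| := by
            by_contra! hlt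
            exact hk (hfh k (by exact_mod_cast hlt))
          have : (n : ℝ) ^ 2 ≤ (k : ℝ) ^ 2 := by
            rw [← sq_abs (k : ℝ)]; gcongr
          push_cast
          nlinarith [sq_nonneg σ]))
  have hfin : ∀ g : UnitAddCircle → ℝ, Continuous g →
      IsFiniteMeasure (volume.withDensity fun x => ENNReal.ofReal (max (g x) 0)) := fun g hg =>
    isFiniteMeasure_withDensity_ofReal (hint _ (by fun_prop)).2
  have := hfin f hf
  have := hfin (fun x => -f x) hf.neg
  have h := ((hsmooth f hf fun x => le_abs_self _).trans hp hmid).trans hp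
    (hsmooth (fun x => -f x) hf.neg fun x => neg_le_abs _).symm
  refine h.mono (le_of_eq ?_)
  have h2 : (2 : ℝ≥0∞) ^ (p - 1) = ENNReal.ofReal (2 ^ (p - 1)) := by
    rw [← ENNReal.ofReal_rpow_of_pos two_pos]; simp
  have hA : 0 ≤ (∫ x, |f x|) * (σ ^ p * (∫⁻ z, ‖z‖ₑ ^ p ∂gaussianReal 0 1).toReal) := by positivity
  simp only [Complex.norm_real, Real.norm_eq_abs, sq_abs]
  rw [h2, ← ENNReal.ofReal_add hA (by positivity), ← ENNReal.ofReal_mul (by positivity),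
    ← ENNReal.ofReal_add (by positivity) hA, ← ENNReal.ofReal_mul (by positivity)]

lemma exp_neg_mul_log_mul_le {p n S D : ℝ} (hp : 1 ≤ p) (hn : 0 < n) (hD : 0 < D) (hDS : D ≤ S) :
    Real.exp (-(p * Real.log (n * S / D))) * S ≤ (n ^ p)⁻¹ * D := by
  have hS : 0 < S := hD.trans_le hDS
  have hr : 1 ≤ S / D := (one_le_div hD).2 hDS
  have h1 : S / D ≤ (S / D) ^ p := by
    simpa using Real.rpow_le_rpow_of_exponent_le hr hp
  have e : Real.exp (-(p * Real.log (n * S / D))) = (n ^ p)⁻¹ * ((S / D) ^ p)⁻¹ := by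
    rw [Real.exp_neg, mul_comm p, ← Real.rpow_def_of_pos (by positivity), mul_div_assoc,
      Real.mul_rpow hn.le (by positivity), mul_inv]
  rw [e, mul_assoc]
  gcongr
  calc ((S / D) ^ p)⁻¹ * S ≤ (S / D)⁻¹ * S := by gcongr
    _ = D := by field_simp

/-- The circle case of Theorem 5 (second part): for `1 ≤ p < ∞` there is `C_p > 0`
such that for every `n ≥ 2` and every continuous `f : 𝕋 → ℝ`, not identically `0`,
whose Fourier coefficients vanish for `|k| < n`,
`W_p(f⁺ dx, f⁻ dx) ≤ C_p (1/n) (log(n ‖f‖₂/‖f‖₁))^{1/2} ‖f‖₁^{1/p}`. -/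
theorem stmt17 (p : ℝ) (hp : 1 ≤ p) : ∃ C : ℝ, 0 < C ∧
    ∀ n : ℕ, 2 ≤ n → ∀ f : UnitAddCircle → ℝ, Continuous f → (∃ x, f x ≠ 0) →
      (∀ k : ℤ, |k| < (n : ℤ) → fhat f k = 0) →
      Wdist p (volume.withDensity fun x => ENNReal.ofReal (max (f x) 0))
          (volume.withDensity fun x => ENNReal.ofReal (max (-f x) 0)) ≤
        C * (1 / (n : ℝ)) *
          Real.sqrt (Real.log ((n : ℝ) * Real.sqrt (∫ x, f x ^ 2) / (∫ x, |f x|))) *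
          (∫ x, |f x|) ^ (1 / p) := by
  have hp0 : 0 < p := by linarith
  set M := (∫⁻ z, ‖z‖ₑ ^ p ∂gaussianReal 0 1).toReal with hM
  have hM0 : 0 ≤ M := ENNReal.toReal_nonneg
  set c : ℝ := 2 ^ (p - 1) with hc
  have hc0 : 0 < c := by positivity
  set a : ℝ := √p ^ p * M with ha
  have ha0 : 0 ≤ a := by positivity
  set b : ℝ := (√(Real.log 2) ^ p)⁻¹ with hb
  have hlog2 : 0 < Real.log 2 := Real.log_pos one_lt_two
  have hb0 : 0 < b := by positivity
  have hQ : 0 < c * (c * (a + b) + a) := by positivity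
  refine ⟨(c * (c * (a + b) + a)) ^ (1 / p), by positivity, ?_⟩
  intro n hn f hf ⟨x₀, hx₀⟩ hfh
  have hint : ∀ g : UnitAddCircle → ℝ, Continuous g → Integrable g := fun g hg =>
    hg.integrable_of_hasCompactSupport (HasCompactSupport.of_compactSpace _)
  set D := ∫ x, |f x| with hD
  set S := √(∫ x, f x ^ 2) with hS
  have hD0 : 0 < D := by
    refine Continuous.integral_pos_of_hasCompactSupport_nonneg_nonzero (x := x₀) (by fun_prop)
      (HasCompactSupport.of_compactSpace _) (fun x => abs_nonneg _) (by simpa using hx₀)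
  have hDS : D ≤ S := by
    have : IsProbabilityMeasure (volume : Measure UnitAddCircle) := by
      rw [UnitAddCircle.volume_eq_haarAddCircle]; infer_instance
    refine Real.le_sqrt_of_sq_le ?_
    have := (even_two.convexOn_pow (𝕜 := ℝ)).map_integral_le (μ := volume) (f := fun x => |f x|)
      (by fun_prop) isClosed_univ (.of_forall fun _ => trivial) (hint _ (by fun_prop))
      (hint _ (by fun_prop))
    simpa only [Function.comp_def, sq_abs] using this
  have hn0 : (0 : ℝ) < n := by positivity
  set L := Real.log (n * S / D) with hL
  have hL2 : Real.log 2 ≤ L := by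
    refine Real.log_le_log two_pos ?_
    rw [mul_div_assoc]
    have h1 : (2 : ℝ) ≤ n := by exact_mod_cast hn
    nlinarith [(one_le_div hD0).2 hDS]
  have hL0 : 0 < L := hlog2.trans_le hL2
  set s := √L / n with hs
  have hs0 : 0 ≤ s := by positivity
  have h := hasCouplingCostLE_posPart_negPart hp hf (by lia) hfh (σ := √p * s) (by positivity)
  rw [← hM, ← hc, ← hD, ← hS] at h
  have hexp : Real.exp (-(n * (√p * s)) ^ 2) * S ≤ b * s ^ p * D := by
    have e : (n * (√p * s)) ^ 2 = p * L := by
      rw [hs, mul_pow, mul_pow, div_pow, Real.sq_sqrt hp0.le, Real.sq_sqrt hL0.le]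
      field_simp
    rw [e]
    refine (exp_neg_mul_log_mul_le hp hn0 hD0 hDS).trans ?_
    gcongr
    rw [hb, hs, Real.div_rpow (by positivity) hn0.le, div_eq_mul_inv, ← mul_assoc]
    refine le_mul_of_one_le_left (by positivity) ?_
    rw [inv_mul_eq_div, one_le_div (by positivity)]
    gcongr
  have hK : c * (c * (D * ((√p * s) ^ p * M) + Real.exp (-(n * (√p * s)) ^ 2) * S)
      + D * ((√p * s) ^ p * M)) ≤ c * (c * (a + b) + a) * s ^ p * D := by
    have e : D * ((√p * s) ^ p * M) = a * s ^ p * D := by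
      rw [Real.mul_rpow (by positivity) hs0, ha]; ring
    rw [e]
    calc _ ≤ c * (c * (a * s ^ p * D + b * s ^ p * D) + a * s ^ p * D) := by gcongr
      _ = _ := by ring
  refine (Wdist_le_of_hasCouplingCostLE hp0 (by positivity)
    (h.mono (ENNReal.ofReal_le_ofReal hK))).trans (le_of_eq ?_)
  rw [Real.mul_rpow (by positivity) hD0.le, Real.mul_rpow hQ.le (by positivity),
    ← Real.rpow_mul hs0, mul_one_div_cancel hp0.ne', Real.rpow_one, hs]
  ring
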